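/- arXiv:1112.2888 — 4 statements merged into one kernel-verified Lean document; each statement's English description precedes it below -/
import Mathlib

section
/- Let m ≥ 1, d ≥ 1, and let f : ℝ^m_{>0} × ℝ^d → ℝ be continuously differentiable in t = (t^1,…,t^m) and twice continuously differentiable in x, and suppose f satisfies the forward diffusion-like PDE system ∂f/∂t^α (t,x) = (1/2) c_α(t) Δ_x f(t,x) for every α = 1,…,m and all (t,x) ∈ ℝ^m_{>0} × ℝ^d. Then f depends on t only through the volume v = t^1⋯t^m: there exists a function g : ℝ_{>0} × ℝ^d → ℝ such that f(t,x) = g(t^1⋯t^m, x) for all t ∈ ℝ^m_{>0} and x ∈ ℝ^d. -/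
open Real Finset

/-- Partial derivative of `f (t, x)` with respect to the time coordinate `t^α`. -/
noncomputable def pderivT {m d : ℕ} (f : (Fin m → ℝ) → (Fin d → ℝ) → ℝ)
    (α : Fin m) (t : Fin m → ℝ) (x : Fin d → ℝ) : ℝ :=
  deriv (fun s => f (Function.update t α s) x) (t α)

/-- Laplacian in the `x`-variables: `Σ_a ∂²f/∂(x^a)²`. -/
noncomputable def lapX {d : ℕ} (f : (Fin d → ℝ) → ℝ) (x : Fin d → ℝ) : ℝ :=
  ∑ a : Fin d, deriv (deriv (fun s => f (Function.update x a s))) (x a)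

/-- Along `γ_α(σ) = exp (a_α + σ b_α)`, a function on the positive orthant whose partial derivatives
are `K t * ∏_{β ≠ α} t_β` has derivative proportional to `∑ α, b_α`. -/
theorem hasDerivAt_comp_exp_line {m : ℕ} {u : (Fin m → ℝ) → ℝ} {K : (Fin m → ℝ) → ℝ}
    (hu : ContDiffOn ℝ 1 u {t : Fin m → ℝ | ∀ α, 0 < t α})
    (hK : ∀ t : Fin m → ℝ, (∀ α, 0 < t α) → ∀ α,
      deriv (fun s => u (Function.update t α s)) (t α) = (∏ β ∈ univ.erase α, t β) * K t)
    (a b : Fin m → ℝ) (σ : ℝ) :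
    HasDerivAt (fun r : ℝ => u fun α => exp (a α + r * b α))
      ((∏ β, exp (a β + σ * b β)) * K (fun α => exp (a α + σ * b α)) * ∑ α, b α) σ := by
  set t : Fin m → ℝ := fun α => exp (a α + σ * b α)
  have ht_pos : ∀ α, 0 < t α := fun α => exp_pos _
  have h_open : IsOpen {t : Fin m → ℝ | ∀ α, 0 < t α} := by
    simp only [Set.ofPred_forall]
    exact isOpen_iInter_of_finite fun α => isOpen_lt continuous_const (continuous_apply α)
  have hfd : HasFDerivAt u (fderiv ℝ u t) t :=
    ((hu.differentiableOn one_ne_zero).differentiableAt (h_open.mem_nhds ht_pos)).hasFDerivAt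
  have h_partial : ∀ α, fderiv ℝ u t (Pi.single α 1) = (∏ β ∈ univ.erase α, t β) * K t := by
    intro α
    rw [← hK t ht_pos α]
    have hfd' : HasFDerivAt u (fderiv ℝ u t) (Function.update t α (t α)) := by simpa using hfd
    exact ((hfd'.comp_hasDerivAt (t α) (hasDerivAt_update t α (t α))).deriv).symm
  have h_path : HasDerivAt (fun r : ℝ => fun α => exp (a α + r * b α)) (fun α => t α * b α) σ := by
    rw [hasDerivAt_pi]
    intro α
    simpa using (((hasDerivAt_id σ).mul_const (b α)).const_add (a α)).exp
  refine (hfd.comp_hasDerivAt σ h_path).congr_deriv ?_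
  rw [← LinearMap.sum_single_apply (fun _ => ℝ) (fun α => t α * b α), map_sum, mul_sum]
  refine sum_congr rfl fun α _ => ?_
  have h_single : (Pi.single α (t α * b α) : Fin m → ℝ) = (t α * b α) • Pi.single α 1 := by
    simp [← Pi.single_smul]
  rw [h_single, map_smul, h_partial, ← mul_prod_erase univ t (mem_univ α), smul_eq_mul]
  ring

/-- A function on the positive orthant whose gradient is parallel to that of the volume function
is constant on the level sets of the volume. -/
theorem eq_of_prod_eq_of_partial_deriv {m : ℕ} {u : (Fin m → ℝ) → ℝ} {K : (Fin m → ℝ) → ℝ}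
    (hu : ContDiffOn ℝ 1 u {t : Fin m → ℝ | ∀ α, 0 < t α})
    (hK : ∀ t : Fin m → ℝ, (∀ α, 0 < t α) → ∀ α,
      deriv (fun s => u (Function.update t α s)) (t α) = (∏ β ∈ univ.erase α, t β) * K t)
    {s t : Fin m → ℝ} (hs : ∀ α, 0 < s α) (ht : ∀ α, 0 < t α) (hst : ∏ α, s α = ∏ α, t α) :
    u s = u t := by
  have h_sum : ∑ α, (log (t α) - log (s α)) = 0 := by
    rw [sum_sub_distrib, ← log_prod fun α _ => (ht α).ne', ← log_prod fun α _ => (hs α).ne', hst,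
      sub_self]
  have h_deriv := hasDerivAt_comp_exp_line hu hK (fun α => log (s α))
    (fun α => log (t α) - log (s α))
  simp only [h_sum, mul_zero] at h_deriv
  have h_const := is_const_of_deriv_eq_zero (fun σ => (h_deriv σ).differentiableAt)
    (fun σ => (h_deriv σ).deriv) 0 1
  simpa [exp_log, hs, ht] using h_const

/-- a solution of the forward diffusion-like PDEs system depends on
`t` only through the volume `v = t^1 ⋯ t^m`. -/
theorem forward_diffusion_volumetric (m d : ℕ) (hm : 1 ≤ m) (hd : 1 ≤ d)
    (f : (Fin m → ℝ) → (Fin d → ℝ) → ℝ)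
    (hft : ∀ x : Fin d → ℝ, ContDiffOn ℝ 1 (fun t => f t x) {t : Fin m → ℝ | ∀ α, 0 < t α})
    (hfx : ∀ t : Fin m → ℝ, (∀ α, 0 < t α) → ContDiff ℝ 2 (f t))
    (hpde : ∀ t : Fin m → ℝ, (∀ α, 0 < t α) → ∀ (x : Fin d → ℝ) (α : Fin m),
      pderivT f α t x = (1 / 2) * (∏ β ∈ Finset.univ.erase α, t β) * lapX (f t) x) :
    ∃ g : ℝ → (Fin d → ℝ) → ℝ, ∀ t : Fin m → ℝ, (∀ α, 0 < t α) →
      ∀ x : Fin d → ℝ, f t x = g (∏ α, t α) x := by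
  let p : ℝ → Fin m → ℝ := fun v => Function.update 1 ⟨0, hm⟩ v
  have hp_prod : ∀ v, ∏ α, p v α = v := fun v => by
    simp [p, prod_update_of_mem (mem_univ _)]
  refine ⟨fun v => f (p v), fun t ht x => ?_⟩
  refine eq_of_prod_eq_of_partial_deriv (K := fun t => 1 / 2 * lapX (f t) x) (hft x) ?_ ht ?_
    (hp_prod _).symm
  · intro s hs α
    rw [← pderivT, hpde s hs x α]
    ring
  · intro α
    by_cases h : α = ⟨0, hm⟩
    · subst h
      simpa [p] using prod_pos fun α _ => ht α
    · simp [p, h]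
end

section
/- Let m ≥ 2 and let f : ℝ^m_{>0} → ℝ be continuously differentiable and satisfy, for all α ≠ β and all t ∈ ℝ^m_{>0}, the proportionality relations c_β(t) ∂f/∂t^α (t) = c_α(t) ∂f/∂t^β (t). Then there exists a function g : ℝ_{>0} → ℝ such that f(t) = g(t^1⋯t^m) for all t ∈ ℝ^m_{>0}. -/
open Real Finset

/-- The partial derivative along a coordinate is the Fréchet derivative on a basis vector. -/
theorem HasFDerivAt.deriv_comp_update {ι : Type*} [Fintype ι] [DecidableEq ι]
    {f : (ι → ℝ) → ℝ} {L : (ι → ℝ) →L[ℝ] ℝ} {t : ι → ℝ} (h : HasFDerivAt f L t) (i : ι) :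
    deriv (fun s => f (Function.update t i s)) (t i) = L (Pi.single i 1) := by
  have hu : HasDerivAt (Function.update t i) (Pi.single i 1) (t i) := hasDerivAt_update t i (t i)
  have h' : HasFDerivAt f L (Function.update t i (t i)) := by
    rwa [Function.update_eq_self]
  exact (h'.comp_hasDerivAt (t i) hu).deriv

/-- A function on the positive orthant whose logarithmic partial derivatives all agree
takes equal values at points with the same coordinate product. -/
theorem eq_of_prod_eq_of_log_partials_eq {ι : Type*} [Fintype ι] [DecidableEq ι]
    {f : (ι → ℝ) → ℝ} {L : (ι → ℝ) → (ι → ℝ) →L[ℝ] ℝ} {K : (ι → ℝ) → ℝ}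
    (hf : ∀ t : ι → ℝ, (∀ i, 0 < t i) → HasFDerivAt f (L t) t)
    (hK : ∀ t : ι → ℝ, (∀ i, 0 < t i) → ∀ i, t i * L t (Pi.single i 1) = K t)
    {x y : ι → ℝ} (hx : ∀ i, 0 < x i) (hy : ∀ i, 0 < y i) (hxy : ∏ i, x i = ∏ i, y i) :
    f x = f y := by
  set d : ι → ℝ := fun i => Real.log (y i) - Real.log (x i) with hd
  have hsum : ∑ i, d i = 0 := by
    rw [Finset.sum_sub_distrib, ← Real.log_prod fun i _ => (hy i).ne',
      ← Real.log_prod fun i _ => (hx i).ne', hxy, sub_self]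
  let p : ℝ → ι → ℝ := fun s i => Real.exp (Real.log (x i) + s * d i)
  have hp : ∀ s i, 0 < p s i := fun s i => Real.exp_pos _
  have hpd : ∀ s, HasDerivAt p (fun i => p s i * d i) s := fun s =>
    hasDerivAt_pi.2 fun i => by
      simpa using (((hasDerivAt_id s).mul_const (d i)).const_add (Real.log (x i))).exp
  have hfd : ∀ s, HasDerivAt (fun s => f (p s)) 0 s := fun s => by
    have h := (hf (p s) (hp s)).comp_hasDerivAt s (hpd s)
    have h0 : L (p s) (fun i => p s i * d i) = 0 := by
      calc L (p s) (fun i => p s i * d i)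
          = ∑ i, (p s i * d i) * L (p s) (Pi.single i 1) := by
            conv_lhs => rw [pi_eq_sum_univ' (fun i => p s i * d i)]
            simp only [map_sum, map_smul, smul_eq_mul]
        _ = ∑ i, K (p s) * d i := Finset.sum_congr rfl fun i _ => by
            rw [← hK (p s) (hp s) i]; ring
        _ = 0 := by rw [← Finset.mul_sum, hsum, mul_zero]
    rwa [h0] at h
  have h01 := is_const_of_deriv_eq_zero (fun s => (hfd s).differentiableAt)
    (fun s => (hfd s).deriv) 0 1
  have hp0 : p 0 = x := by
    funext i; simp [p, Real.exp_log (hx i)]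
  have hp1 : p 1 = y := by
    funext i; simp [p, hd, Real.exp_log (hy i)]
  simpa only [hp0, hp1] using h01

/-- if the first-order partial derivatives of `f` satisfy the
proportionality relations `c_β(t) ∂f/∂t^α = c_α(t) ∂f/∂t^β` on the positive
orthant, then `f` is a function of the volume `v = t^1 ⋯ t^m` alone. -/
theorem proportional_partials_volumetric (m : ℕ) (hm : 2 ≤ m)
    (f : (Fin m → ℝ) → ℝ)
    (hf : ContDiffOn ℝ 1 f {t : Fin m → ℝ | ∀ α, 0 < t α})
    (hprop : ∀ t : Fin m → ℝ, (∀ α, 0 < t α) → ∀ α β : Fin m, α ≠ β →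
      (∏ γ ∈ Finset.univ.erase β, t γ) *
          deriv (fun s => f (Function.update t α s)) (t α)
        = (∏ γ ∈ Finset.univ.erase α, t γ) *
            deriv (fun s => f (Function.update t β s)) (t β)) :
    ∃ g : ℝ → ℝ, ∀ t : Fin m → ℝ, (∀ α, 0 < t α) → f t = g (∏ α, t α) := by
  let i₀ : Fin m := ⟨0, by omega⟩
  have hopen : IsOpen {t : Fin m → ℝ | ∀ α, 0 < t α} := by
    simp only [Set.ofPred_forall]
    exact isOpen_iInter_of_finite fun α => isOpen_lt continuous_const (continuous_apply α)
  have hfd : ∀ t : Fin m → ℝ, (∀ α, 0 < t α) → HasFDerivAt f (fderiv ℝ f t) t := fun t ht =>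
    ((hf.differentiableOn one_ne_zero).differentiableAt (hopen.mem_nhds ht)).hasFDerivAt
  have hlog : ∀ t : Fin m → ℝ, (∀ α, 0 < t α) → ∀ α,
      t α * fderiv ℝ f t (Pi.single α 1) = t i₀ * fderiv ℝ f t (Pi.single i₀ 1) := by
    intro t ht α
    rcases eq_or_ne α i₀ with rfl | hα
    · rfl
    have h := hprop t ht α i₀ hα
    rw [(hfd t ht).deriv_comp_update, (hfd t ht).deriv_comp_update] at h
    have hv : ∏ γ, t γ ≠ 0 := Finset.prod_ne_zero_iff.2 fun γ _ => (ht γ).ne'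
    have h₀ := Finset.mul_prod_erase Finset.univ t (Finset.mem_univ i₀)
    have h₁ := Finset.mul_prod_erase Finset.univ t (Finset.mem_univ α)
    apply mul_left_cancel₀ hv
    linear_combination t α * t i₀ * h - t α * fderiv ℝ f t (Pi.single α 1) * h₀
      + t i₀ * fderiv ℝ f t (Pi.single i₀ 1) * h₁
  refine ⟨fun v => f (Function.update 1 i₀ v), fun t ht =>
    eq_of_prod_eq_of_log_partials_eq hfd hlog ht (fun i => ?_) ?_⟩
  · rcases eq_or_ne i i₀ with rfl | hi
    · simpa using Finset.prod_pos fun γ _ => ht γ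
    · simp [Function.update_of_ne hi]
  · simp [Finset.prod_update_of_mem]
end

section
/- Let m ≥ 1, d ≥ 1, and let f : ℝ^m_{>0} × ℝ^d → ℝ be continuously differentiable in t = (t^1,…,t^m) and twice continuously differentiable in x, and suppose f satisfies the backward diffusion-like PDE system ∂f/∂t^α (t,x) + (1/2) c_α(t) Δ_x f(t,x) = 0 for every α = 1,…,m and all (t,x) ∈ ℝ^m_{>0} × ℝ^d. Then f depends on t only through the volume v = t^1⋯t^m: there exists a function g : ℝ_{>0} × ℝ^d → ℝ such that f(t,x) = g(t^1⋯t^m, x) for all t ∈ ℝ^m_{>0} and x ∈ ℝ^d. -/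
open Real Finset

/-- Along the curve `s ↦ exp (a + s b)` with `∑ b = 0`, a function whose gradient is everywhere
parallel to that of the volume function is constant; hence such a function takes equal values at
points of the positive orthant with equal volume. -/
lemma eq_of_fderiv_parallel_volume {ι : Type*} [Fintype ι] [DecidableEq ι]
    {F : (ι → ℝ) → ℝ} {k : (ι → ℝ) → ℝ}
    (hF : ∀ t : ι → ℝ, (∀ α, 0 < t α) → DifferentiableAt ℝ F t)
    (hk : ∀ t : ι → ℝ, (∀ α, 0 < t α) → ∀ α,
      fderiv ℝ F t (Pi.single α 1) = k t * ∏ β ∈ univ.erase α, t β)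
    {t t' : ι → ℝ} (ht : ∀ α, 0 < t α) (ht' : ∀ α, 0 < t' α) (h : ∏ α, t α = ∏ α, t' α) :
    F t = F t' := by
  set b : ι → ℝ := fun α => log (t' α) - log (t α) with hb
  set γ : ℝ → ι → ℝ := fun s α => exp (log (t α) + s * b α) with hγ
  have hb0 : ∑ α, b α = 0 := by
    simp only [hb, Finset.sum_sub_distrib]
    rw [← Real.log_prod fun α _ => (ht α).ne', ← Real.log_prod fun α _ => (ht' α).ne', h, sub_self]
  have hγpos : ∀ s α, 0 < γ s α := fun s α => exp_pos _
  have hγd : ∀ s, HasDerivAt γ (fun α => γ s α * b α) s := fun s => by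
    rw [hasDerivAt_pi]
    intro α
    simpa using (((hasDerivAt_id s).mul_const (b α)).const_add (log (t α))).exp
  have hd : ∀ s, HasDerivAt (fun s => F (γ s)) 0 s := fun s => by
    have hcomp := (hF _ (hγpos s)).hasFDerivAt.comp_hasDerivAt s (hγd s)
    have hterm : ∀ α, fderiv ℝ F (γ s) ((γ s α * b α) • Pi.single α 1)
        = k (γ s) * (∏ β, γ s β) * b α := fun α => by
      rw [map_smul, hk _ (hγpos s), ← Finset.mul_prod_erase univ (γ s) (mem_univ α), smul_eq_mul]
      ring
    have hsum : ∑ α, fderiv ℝ F (γ s) ((γ s α * b α) • Pi.single α 1) = 0 := by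
      simp_rw [hterm, ← Finset.mul_sum, hb0, mul_zero]
    have hzero : fderiv ℝ F (γ s) (fun α => γ s α * b α) = 0 := by
      rw [← hsum, ← map_sum]
      congr 1
      ext β
      simp [Finset.sum_apply, Pi.single_apply]
    rw [hzero] at hcomp
    exact hcomp
  have hconst := is_const_of_deriv_eq_zero (fun s => (hd s).differentiableAt)
    (fun s => (hd s).deriv) 0 1
  have h0 : γ 0 = t := by
    ext α
    simp [hγ, exp_log (ht α)]
  have h1 : γ 1 = t' := by
    ext α
    simp [hγ, hb, exp_log (ht' α)]
  simpa only [h0, h1] using hconst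

/-- The partial derivative in time is the Fréchet derivative along the coordinate direction. -/
lemma pderivT_eq_fderiv {m d : ℕ} {f : (Fin m → ℝ) → (Fin d → ℝ) → ℝ} {t : Fin m → ℝ}
    {x : Fin d → ℝ} (hf : DifferentiableAt ℝ (fun t => f t x) t) (α : Fin m) :
    pderivT f α t x = fderiv ℝ (fun t => f t x) t (Pi.single α 1) := by
  have hf' : HasFDerivAt (fun t => f t x) (fderiv ℝ (fun t => f t x) t)
      (Function.update t α (t α)) := by
    rw [Function.update_eq_self]
    exact hf.hasFDerivAt
  exact (hf'.comp_hasDerivAt (t α) (hasDerivAt_update t α (t α))).deriv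

/-- a solution of the backward diffusion-like PDEs system depends on
`t` only through the volume `v = t^1 ⋯ t^m`. -/
theorem backward_diffusion_volumetric (m d : ℕ) (hm : 1 ≤ m) (hd : 1 ≤ d)
    (f : (Fin m → ℝ) → (Fin d → ℝ) → ℝ)
    (hft : ∀ x : Fin d → ℝ, ContDiffOn ℝ 1 (fun t => f t x) {t : Fin m → ℝ | ∀ α, 0 < t α})
    (hfx : ∀ t : Fin m → ℝ, (∀ α, 0 < t α) → ContDiff ℝ 2 (f t))
    (hpde : ∀ t : Fin m → ℝ, (∀ α, 0 < t α) → ∀ (x : Fin d → ℝ) (α : Fin m),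
      pderivT f α t x + (1 / 2) * (∏ β ∈ Finset.univ.erase α, t β) * lapX (f t) x = 0) :
    ∃ g : ℝ → (Fin d → ℝ) → ℝ, ∀ t : Fin m → ℝ, (∀ α, 0 < t α) →
      ∀ x : Fin d → ℝ, f t x = g (∏ α, t α) x := by
  have hopen : IsOpen {t : Fin m → ℝ | ∀ α, 0 < t α} := by
    simp only [Set.ofPred_forall]
    exact isOpen_iInter_of_finite fun α => isOpen_lt continuous_const (continuous_apply α)
  have hF : ∀ x t, (∀ α, 0 < t α) → DifferentiableAt ℝ (fun t => f t x) t := fun x t ht =>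
    ((hft x).differentiableOn one_ne_zero).differentiableAt (hopen.mem_nhds ht)
  let i : Fin m := ⟨0, hm⟩
  refine ⟨fun v => f (Function.update 1 i v), fun t ht x => ?_⟩
  refine eq_of_fderiv_parallel_volume (k := fun t => -(1 / 2) * lapX (f t) x) (hF x)
    (fun s hs α => ?_) ht (fun α => ?_) ?_
  · rw [← pderivT_eq_fderiv (hF x s hs)]
    linear_combination hpde s hs x α
  · rcases eq_or_ne α i with rfl | hα
    · simpa using Finset.prod_pos fun β _ => ht β
    · simp [hα]
  · simp [Finset.prod_update_of_mem (mem_univ i)]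
end

section
/- Let f : ℝ^d → ℝ be continuous and bounded, and define u(t,x) = ∫_{ℝ^d} f(y) K(t;x,y) dy for t ∈ ℝ^m_{>0} and x ∈ ℝ^d, where K(t;x,y) = (2π t^1⋯t^m)^{−d/2} exp(−‖x−y‖²/(2 t^1⋯t^m)). Then u is smooth in (t,x) on ℝ^m_{>0} × ℝ^d and satisfies the forward multitime heat PDEs ∂u/∂t^α (t,x) = (1/2) c_α(t) Δ_x u(t,x) for every α = 1,…,m and all (t,x) ∈ ℝ^m_{>0} × ℝ^d. -/
open Real Finset MeasureTheory

/-- The Gaussian transition kernel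
`K(t;x,y) = (2π t^1⋯t^m)^{-d/2} exp(-‖x-y‖²/(2 t^1⋯t^m))`. -/
noncomputable def gaussK (m d : ℕ) (t : Fin m → ℝ) (x y : Fin d → ℝ) : ℝ :=
  (2 * π * ∏ α, t α) ^ (-(d : ℝ) / 2) *
    Real.exp (-(∑ a, (x a - y a) ^ 2) / (2 * ∏ α, t α))

/-- The forward mean value `u(t,x) = ∫_{ℝ^d} f(y) K(t;x,y) dy`. -/
noncomputable def meanValU (m d : ℕ) (f : (Fin d → ℝ) → ℝ)
    (t : Fin m → ℝ) (x : Fin d → ℝ) : ℝ :=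
  ∫ y : Fin d → ℝ, f y * gaussK m d t x y

/-- The linear functional `(s, z) ↦ -s ‖y‖² + z ⬝ y`, i.e. the exponent of the Gaussian kernel in
natural parameters. -/
noncomputable def gaussExponent {d : ℕ} (y : Fin d → ℝ) : (ℝ × (Fin d → ℝ)) →L[ℝ] ℝ :=
  (-(∑ a, y a ^ 2)) • ContinuousLinearMap.fst ℝ ℝ (Fin d → ℝ) +
    ∑ a, y a • (ContinuousLinearMap.proj a).comp (ContinuousLinearMap.snd ℝ ℝ (Fin d → ℝ))

theorem gaussExponent_apply {d : ℕ} (y : Fin d → ℝ) (p : ℝ × (Fin d → ℝ)) :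
    gaussExponent y p = -(∑ a, y a ^ 2) * p.1 + ∑ a, y a * p.2 a := by
  simp [gaussExponent]

theorem continuous_gaussExponent {d : ℕ} :
    Continuous (gaussExponent : (Fin d → ℝ) → (ℝ × (Fin d → ℝ)) →L[ℝ] ℝ) := by
  unfold gaussExponent
  fun_prop

/-- Continuous functions growing slower than every Gaussian. -/
def IsSubgaussian {d : ℕ} {F : Type} [NormedAddCommGroup F] (g : (Fin d → ℝ) → F) : Prop :=
  Continuous g ∧ ∀ b : ℝ, 0 < b → ∃ C : ℝ, ∀ y, ‖g y‖ ≤ C * Real.exp (b * ∑ a, y a ^ 2)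

theorem integrable_exp_neg_mul_sum_sq {d : ℕ} {b : ℝ} (hb : 0 < b) :
    Integrable fun y : Fin d → ℝ => Real.exp (-b * ∑ a, y a ^ 2) := by
  have := Integrable.fintype_prod (ι := Fin d) (fun _ => integrable_exp_neg_mul_sq hb)
  simp only [Finset.mul_sum, Real.exp_sum]
  exact this

theorem gaussExponent_le {d : ℕ} {s R : ℝ} (hs : 0 < s) (y : Fin d → ℝ) (p : ℝ × (Fin d → ℝ))
    (hp : s ≤ p.1) (hR : ‖p.2‖ ≤ R) :
    gaussExponent y p ≤ -(s / 2) * ∑ a, y a ^ 2 + d * (R ^ 2 / (2 * s)) := by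
  rw [gaussExponent_apply]
  have h1 : ∑ a, y a * p.2 a ≤ ∑ a : Fin d, ((s / 2) * y a ^ 2 + R ^ 2 / (2 * s)) := by
    refine Finset.sum_le_sum fun a _ => ?_
    have h2 : |p.2 a| ≤ R := (norm_le_pi_norm p.2 a).trans hR
    have h3 : (p.2 a) ^ 2 ≤ R ^ 2 := sq_le_sq' (abs_le.1 h2).1 (abs_le.1 h2).2
    have h4 : y a * p.2 a ≤ (s / 2) * y a ^ 2 + (p.2 a) ^ 2 / (2 * s) := by
      have : (s / 2) * y a ^ 2 + (p.2 a) ^ 2 / (2 * s) - y a * p.2 a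
          = (s * y a - p.2 a) ^ 2 / (2 * s) := by field_simp; ring
      have : 0 ≤ (s * y a - p.2 a) ^ 2 / (2 * s) := by positivity
      linarith
    have h5 : (p.2 a) ^ 2 / (2 * s) ≤ R ^ 2 / (2 * s) := by gcongr
    linarith
  rw [Finset.sum_add_distrib, ← Finset.mul_sum] at h1
  simp only [Finset.sum_const, Finset.card_univ, Fintype.card_fin, nsmul_eq_mul] at h1
  have h6 : 0 ≤ ∑ a, y a ^ 2 := Finset.sum_nonneg fun a _ => sq_nonneg _
  nlinarith

namespace IsSubgaussian

variable {d : ℕ} {F : Type} [NormedAddCommGroup F] {g : (Fin d → ℝ) → F}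

theorem exists_integrable_bound (hg : IsSubgaussian g) {s R : ℝ} (hs : 0 < s) :
    ∃ B : (Fin d → ℝ) → ℝ, Integrable B ∧ ∀ p : ℝ × (Fin d → ℝ), s ≤ p.1 → ‖p.2‖ ≤ R →
      ∀ y, Real.exp (gaussExponent y p) * ‖g y‖ ≤ B y := by
  obtain ⟨C, hC⟩ := hg.2 (s / 4) (by positivity)
  refine ⟨fun y => Real.exp (d * (R ^ 2 / (2 * s))) * C *
    Real.exp (-(s / 4) * ∑ a, y a ^ 2),
    (integrable_exp_neg_mul_sum_sq (by positivity)).const_mul _, fun p hp hR y => ?_⟩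
  calc Real.exp (gaussExponent y p) * ‖g y‖
      ≤ Real.exp (-(s / 2) * ∑ a, y a ^ 2 + d * (R ^ 2 / (2 * s))) *
          (C * Real.exp (s / 4 * ∑ a, y a ^ 2)) := by
        gcongr
        · exact gaussExponent_le hs y p hp hR
        · exact hC y
    _ = Real.exp (d * (R ^ 2 / (2 * s))) * C * Real.exp (-(s / 4) * ∑ a, y a ^ 2) := by
        have : -(s / 4) * ∑ a, y a ^ 2 = -(s / 2) * ∑ a, y a ^ 2 + s / 4 * ∑ a, y a ^ 2 := by ring
        rw [this, Real.exp_add, Real.exp_add]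
        ring

theorem mul_of_norm_le {F' : Type} [NormedAddCommGroup F'] {h : (Fin d → ℝ) → F'}
    (hg : IsSubgaussian g) (hc : Continuous h) {A : ℝ}
    (hh : ∀ y, ‖h y‖ ≤ (A + 2 * ∑ a, y a ^ 2) * ‖g y‖) : IsSubgaussian h := by
  refine ⟨hc, fun b hb => ?_⟩
  obtain ⟨C, hC⟩ := hg.2 (b / 2) (by positivity)
  refine ⟨(|A| + 4 / b) * C, fun y => (hh y).trans ?_⟩
  set q := ∑ a, y a ^ 2
  have hq : 0 ≤ q := Finset.sum_nonneg fun a _ => sq_nonneg _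
  have h1 : b / 2 * q + 1 ≤ Real.exp (b / 2 * q) := Real.add_one_le_exp _
  have h3 : 1 ≤ Real.exp (b / 2 * q) := Real.one_le_exp (by positivity)
  have h2 : A + 2 * q ≤ (|A| + 4 / b) * Real.exp (b / 2 * q) := by
    have e1 : A ≤ |A| * Real.exp (b / 2 * q) :=
      (le_abs_self A).trans (le_mul_of_one_le_right (abs_nonneg A) h3)
    have e2 : 2 * q ≤ 4 / b * Real.exp (b / 2 * q) := by
      calc 2 * q = 4 / b * (b / 2 * q) := by field_simp; ring
        _ ≤ _ := by gcongr; linarith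
    linarith
  calc (A + 2 * q) * ‖g y‖
      ≤ ((|A| + 4 / b) * Real.exp (b / 2 * q)) * (C * Real.exp (b / 2 * q)) := by
        apply mul_le_mul h2 (hC y) (norm_nonneg _) (by positivity)
    _ = _ := by
        have : b * q = b / 2 * q + b / 2 * q := by ring
        rw [this, Real.exp_add]; ring

theorem of_bounded (hc : Continuous g) {C : ℝ} (hC : ∀ y, ‖g y‖ ≤ C) : IsSubgaussian g := by
  refine ⟨hc, fun b hb => ⟨C, fun y => (hC y).trans ?_⟩⟩
  refine le_mul_of_one_le_right ((norm_nonneg _).trans (hC 0)) (Real.one_le_exp ?_)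
  exact mul_nonneg hb.le (Finset.sum_nonneg fun a _ => sq_nonneg _)

theorem coord_mul {g : (Fin d → ℝ) → ℝ} (hg : IsSubgaussian g) (a : Fin d) :
    IsSubgaussian fun y => y a * g y := by
  refine hg.mul_of_norm_le (A := 1) (by have := hg.1; fun_prop) fun y => ?_
  rw [norm_mul]
  gcongr
  have h : y a ^ 2 ≤ ∑ a, y a ^ 2 :=
    Finset.single_le_sum (f := fun a => y a ^ 2) (fun a _ => sq_nonneg _) (Finset.mem_univ a)
  rw [Real.norm_eq_abs, abs_le]
  constructor <;> nlinarith [sq_nonneg (y a - 1), sq_nonneg (y a + 1)]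

variable [NormedSpace ℝ F]

theorem integrable (hg : IsSubgaussian g) {p : ℝ × (Fin d → ℝ)} (hp : 0 < p.1) :
    Integrable fun y => Real.exp (gaussExponent y p) • g y := by
  obtain ⟨B, hB, h⟩ := hg.exists_integrable_bound hp (R := ‖p.2‖)
  refine hB.mono' ?_ (.of_forall fun y => ?_)
  · have := hg.1
    have := continuous_gaussExponent (d := d)
    exact Continuous.aestronglyMeasurable (by fun_prop)
  · rw [norm_smul, Real.norm_eq_abs, Real.abs_exp]
    exact h p le_rfl le_rfl y

theorem smulRight (hg : IsSubgaussian g) :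
    IsSubgaussian fun y => (gaussExponent y).smulRight (g y) := by
  refine hg.mul_of_norm_le (A := d) ?_ fun y => ?_
  · exact ((ContinuousLinearMap.smulRightL ℝ (ℝ × (Fin d → ℝ)) F).continuous.comp
      continuous_gaussExponent).clm_apply hg.1
  · rw [ContinuousLinearMap.norm_smulRight_apply]
    gcongr
    have hq : 0 ≤ ∑ a, y a ^ 2 := Finset.sum_nonneg fun a _ => sq_nonneg _
    refine ContinuousLinearMap.opNorm_le_bound _ (by positivity) fun p => ?_
    rw [gaussExponent_apply]
    have h1 : |(∑ a, y a ^ 2) * p.1| ≤ (∑ a, y a ^ 2) * ‖p‖ := by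
      rw [abs_mul, abs_of_nonneg hq]
      gcongr
      exact norm_fst_le p
    have h2 : |∑ a, y a * p.2 a| ≤ (d + ∑ a, y a ^ 2) * ‖p‖ := by
      calc |∑ a, y a * p.2 a| ≤ ∑ a, |y a * p.2 a| := Finset.abs_sum_le_sum_abs _ _
        _ ≤ ∑ a, (1 + y a ^ 2) * ‖p‖ := by
          refine Finset.sum_le_sum fun a _ => ?_
          rw [abs_mul]
          have : |p.2 a| ≤ ‖p‖ := (norm_le_pi_norm p.2 a).trans (norm_snd_le p)
          have : |y a| ≤ 1 + y a ^ 2 := by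
            rw [abs_le]
            constructor <;> nlinarith [sq_nonneg (y a - 1), sq_nonneg (y a + 1)]
          gcongr
        _ = _ := by simp [← Finset.sum_mul, Finset.sum_add_distrib]
    rw [Real.norm_eq_abs, neg_mul]
    calc |-((∑ a, y a ^ 2) * p.1) + ∑ a, y a * p.2 a|
        ≤ |(∑ a, y a ^ 2) * p.1| + |∑ a, y a * p.2 a| := by
          simpa using abs_add_le (-((∑ a, y a ^ 2) * p.1)) (∑ a, y a * p.2 a)
      _ ≤ _ := by linarith

theorem hasFDerivAt_integral (hg : IsSubgaussian g) {p : ℝ × (Fin d → ℝ)} (hp : 0 < p.1) :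
    HasFDerivAt (fun p => ∫ y, Real.exp (gaussExponent y p) • g y)
      (∫ y, Real.exp (gaussExponent y p) • (gaussExponent y).smulRight (g y)) p := by
  obtain ⟨B, hB, h⟩ := hg.smulRight.exists_integrable_bound (half_pos hp) (R := ‖p‖ + p.1 / 2)
  have hcg := hg.1
  have hce := continuous_gaussExponent (d := d)
  refine hasFDerivAt_integral_of_dominated_of_fderiv_le
    (F' := fun p y => Real.exp (gaussExponent y p) • (gaussExponent y).smulRight (g y))
    (bound := B) (Metric.ball_mem_nhds p (half_pos hp)) (.of_forall fun p' => ?_)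
    (hg.integrable hp) (hg.smulRight.integrable hp).aestronglyMeasurable
    (.of_forall fun y p' hp' => ?_) hB (.of_forall fun y p' _ => ?_)
  · exact Continuous.aestronglyMeasurable (by fun_prop)
  · rw [norm_smul, Real.norm_eq_abs, Real.abs_exp]
    rw [mem_ball_iff_norm] at hp'
    refine h p' ?_ ?_ y
    · have h1 : |p'.1 - p.1| < p.1 / 2 := (norm_fst_le (p' - p)).trans_lt hp'
      linarith [(abs_lt.1 h1).1]
    · have h2 := norm_sub_norm_le p' p
      linarith [norm_snd_le p']
  · convert ((gaussExponent y).hasFDerivAt (x := p')).exp.smul_const (g y) using 1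
    ext v <;> simp [mul_smul]

theorem contDiffOn_integral (n : ℕ) {F : Type} [NormedAddCommGroup F] [NormedSpace ℝ F]
    {g : (Fin d → ℝ) → F} (hg : IsSubgaussian g) :
    ContDiffOn ℝ n (fun p => ∫ y, Real.exp (gaussExponent y p) • g y)
      {p : ℝ × (Fin d → ℝ) | 0 < p.1} := by
  have hopen : IsOpen {p : ℝ × (Fin d → ℝ) | 0 < p.1} := isOpen_lt continuous_const continuous_fst
  induction n generalizing F with
  | zero =>
    exact contDiffOn_zero.2 fun p hp =>
      (hg.hasFDerivAt_integral hp).continuousAt.continuousWithinAt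
  | succ n ih =>
    push_cast
    rw [contDiffOn_succ_iff_fderiv_of_isOpen hopen]
    refine ⟨fun p hp => (hg.hasFDerivAt_integral hp).differentiableAt.differentiableWithinAt,
      fun h => by simp at h, (ih hg.smulRight).congr fun p hp => ?_⟩
    exact (hg.hasFDerivAt_integral hp).fderiv

end IsSubgaussian

/-- The Gaussian-weighted integral in natural parameters. -/
noncomputable def gaussTransform {d : ℕ} (g : (Fin d → ℝ) → ℝ) (p : ℝ × (Fin d → ℝ)) : ℝ :=
  ∫ y, Real.exp (gaussExponent y p) • g y

/-- `∫ exp (-s ‖x - y‖²) g(y) dy`, with the square expanded. -/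
noncomputable def gaussAverage {d : ℕ} (g : (Fin d → ℝ) → ℝ) (s : ℝ) (x : Fin d → ℝ) : ℝ :=
  Real.exp (-s * ∑ a, x a ^ 2) * gaussTransform g (s, (2 * s) • x)

theorem meanValU_eq_gaussAverage {m d : ℕ} (f : (Fin d → ℝ) → ℝ) (t : Fin m → ℝ)
    (x : Fin d → ℝ) :
    meanValU m d f t x =
      (2 * π * ∏ α, t α) ^ (-(d : ℝ) / 2) * gaussAverage f (2 * ∏ α, t α)⁻¹ x := by
  rw [gaussAverage, gaussTransform, ← integral_const_mul, ← integral_const_mul, meanValU]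
  congr 1 with y
  have : -(∑ a, (x a - y a) ^ 2) / (2 * ∏ α, t α)
      = -(2 * ∏ α, t α)⁻¹ * ∑ a, x a ^ 2
        + gaussExponent y ((2 * ∏ α, t α)⁻¹, (2 * (2 * ∏ α, t α)⁻¹) • x) := by
    rw [gaussExponent_apply, div_eq_mul_inv]
    simp only [Pi.smul_apply, smul_eq_mul, Finset.mul_sum, Finset.sum_mul, ← Finset.sum_neg_distrib,
      ← Finset.sum_add_distrib]
    exact Finset.sum_congr rfl fun a _ => by ring
  rw [gaussK, this, Real.exp_add, smul_eq_mul]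
  ring

namespace IsSubgaussian

variable {d : ℕ} {g : (Fin d → ℝ) → ℝ}

theorem integral_smulRight_apply (hg : IsSubgaussian g) {p : ℝ × (Fin d → ℝ)} (hp : 0 < p.1)
    (w : ℝ × (Fin d → ℝ)) :
    (∫ y, Real.exp (gaussExponent y p) • (gaussExponent y).smulRight (g y)) w =
      ∑ a, (w.2 a * gaussTransform (fun y => y a * g y) p
        - w.1 * gaussTransform (fun y => y a * (y a * g y)) p) := by
  have h1 (a : Fin d) := (hg.coord_mul a).integrable hp
  have h2 (a : Fin d) := ((hg.coord_mul a).coord_mul a).integrable hp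
  rw [ContinuousLinearMap.integral_apply (hg.smulRight.integrable hp)]
  simp only [gaussTransform]
  simp_rw [← integral_const_mul]
  simp_rw [← fun a => integral_sub ((h1 a).const_mul (w.2 a)) ((h2 a).const_mul w.1)]
  rw [← integral_finsetSum _ fun a _ => by
    exact ((h1 a).const_mul (w.2 a)).sub ((h2 a).const_mul w.1)]
  congr 1 with y
  simp only [smul_apply, ContinuousLinearMap.smulRight_apply,
    gaussExponent_apply, smul_eq_mul, Finset.mul_sum, Finset.sum_mul, ← Finset.sum_neg_distrib,
    ← Finset.sum_add_distrib]
  exact Finset.sum_congr rfl fun a _ => by ring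

theorem hasDerivAt_gaussAverage_update (hg : IsSubgaussian g) {s : ℝ} (hs : 0 < s)
    (x : Fin d → ℝ) (a : Fin d) (r : ℝ) :
    HasDerivAt (fun r => gaussAverage g s (Function.update x a r))
      (2 * s * (gaussAverage (fun y => y a * g y) s (Function.update x a r)
        - r * gaussAverage g s (Function.update x a r))) r := by
  have hu := hasDerivAt_update x a r
  have hq : HasDerivAt (fun r => ∑ b, Function.update x a r b ^ 2) (2 * r) r := by
    have := HasDerivAt.fun_sum (u := Finset.univ) fun b _ => (hasDerivAt_pi.1 hu b).fun_pow 2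
    convert! this using 1
    simp [Pi.single_apply]
  have hT := (hg.hasFDerivAt_integral (p := (s, (2 * s) • Function.update x a r))
    hs).comp_hasDerivAt r ((hasDerivAt_const r s).prodMk (hu.const_smul (2 * s)))
  rw [hg.integral_smulRight_apply hs] at hT
  convert! (hq.const_mul (-s)).exp.fun_mul hT using 1
  simp only [gaussAverage, gaussTransform, Function.comp_apply, Pi.smul_apply, smul_eq_mul,
    zero_mul, sub_zero, Pi.single_apply, mul_ite, mul_one, mul_zero, ite_mul, Finset.sum_ite_eq',
    Finset.mem_univ, if_true]
  ring

theorem lapX_gaussAverage (hg : IsSubgaussian g) {s : ℝ} (hs : 0 < s) (x : Fin d → ℝ) :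
    lapX (gaussAverage g s) x =
      ∑ a, (4 * s ^ 2 * (gaussAverage (fun y => y a * (y a * g y)) s x
        - 2 * x a * gaussAverage (fun y => y a * g y) s x + x a ^ 2 * gaussAverage g s x)
        - 2 * s * gaussAverage g s x) := by
  refine Finset.sum_congr rfl fun a _ => ?_
  rw [funext fun r => (hg.hasDerivAt_gaussAverage_update hs x a r).deriv]
  have h1 := hg.hasDerivAt_gaussAverage_update hs x a (x a)
  have h2 := (hg.coord_mul a).hasDerivAt_gaussAverage_update hs x a (x a)
  rw [((h2.fun_sub ((hasDerivAt_id' (x a)).fun_mul h1)).const_mul (2 * s)).deriv, Function.update_eq_self]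
  ring

theorem hasDerivAt_gaussAverage_left (hg : IsSubgaussian g) {s : ℝ} (hs : 0 < s)
    (x : Fin d → ℝ) :
    HasDerivAt (fun s => gaussAverage g s x)
      (-∑ a, (gaussAverage (fun y => y a * (y a * g y)) s x
        - 2 * x a * gaussAverage (fun y => y a * g y) s x + x a ^ 2 * gaussAverage g s x)) s := by
  have hT := (hg.hasFDerivAt_integral (p := (s, (2 * s) • x)) hs).comp_hasDerivAt
    s ((hasDerivAt_id' s).prodMk (((hasDerivAt_id' s).const_mul 2).smul_const x))
  rw [hg.integral_smulRight_apply hs] at hT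
  convert! (((hasDerivAt_id' s).fun_neg.mul_const (∑ a, x a ^ 2)).exp.fun_mul hT) using 1
  simp only [gaussAverage, gaussTransform, Function.comp_apply, Pi.smul_apply, smul_eq_mul,
    Finset.mul_sum, Finset.sum_mul, ← Finset.sum_neg_distrib, ← Finset.sum_add_distrib]
  refine Finset.sum_congr rfl fun a _ => ?_
  ring

end IsSubgaussian

theorem lapX_const_mul {d : ℕ} (c : ℝ) (h : (Fin d → ℝ) → ℝ) (x : Fin d → ℝ) :
    lapX (fun x => c * h x) x = c * lapX h x := by
  simp only [lapX, deriv_const_mul_field', Finset.mul_sum]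

/-- In the scalar time `v`, the Gaussian mean value solves the heat equation `∂ᵥ u = ½ Δ u`. -/
theorem IsSubgaussian.hasDerivAt_heat {d : ℕ} {g : (Fin d → ℝ) → ℝ} (hg : IsSubgaussian g)
    {v : ℝ} (hv : 0 < v) (x : Fin d → ℝ) :
    HasDerivAt (fun v => (2 * π * v) ^ (-(d : ℝ) / 2) * gaussAverage g (2 * v)⁻¹ x)
      (1 / 2 * ((2 * π * v) ^ (-(d : ℝ) / 2) * lapX (gaussAverage g (2 * v)⁻¹) x)) v := by
  have hs : 0 < (2 * v)⁻¹ := by positivity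
  have hpos : 0 < 2 * π * v := by positivity
  have h1 := ((hasDerivAt_id' v).const_mul (2 * π)).rpow_const (p := -(d : ℝ) / 2) (.inl hpos.ne')
  have h2 := (hg.hasDerivAt_gaussAverage_left hs x).comp v
    (((hasDerivAt_id' v).const_mul 2).fun_inv (by positivity))
  convert! h1.fun_mul h2 using 1
  rw [hg.lapX_gaussAverage hs, Finset.sum_sub_distrib, ← Finset.mul_sum, Real.rpow_sub_one hpos.ne']
  simp only [Finset.sum_const, Finset.card_univ, Fintype.card_fin, nsmul_eq_mul,
    Function.comp_apply]
  generalize ∑ a, (gaussAverage (fun y => y a * (y a * g y)) (2 * v)⁻¹ x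
    - 2 * x a * gaussAverage (fun y => y a * g y) (2 * v)⁻¹ x
    + x a ^ 2 * gaussAverage g (2 * v)⁻¹ x) = S
  field_simp
  ring

/-- for `f` continuous and bounded, the forward mean value
`u(t,x) = ∫ f(y) K(t;x,y) dy` is smooth on the orthant and satisfies the
forward multitime heat PDEs `∂u/∂t^α = (1/2) c_α(t) Δ_x u`. -/
theorem meanValU_forward_heat (m d : ℕ) (hm : 1 ≤ m) (hd : 1 ≤ d)
    (f : (Fin d → ℝ) → ℝ) (hf : Continuous f) (hfb : ∃ C : ℝ, ∀ y, |f y| ≤ C) :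
    ContDiffOn ℝ (⊤ : ℕ∞)
      (fun p : (Fin m → ℝ) × (Fin d → ℝ) => meanValU m d f p.1 p.2)
      ({t : Fin m → ℝ | ∀ α, 0 < t α} ×ˢ (Set.univ : Set (Fin d → ℝ)))
    ∧ ∀ (α : Fin m) (t : Fin m → ℝ), (∀ β, 0 < t β) → ∀ x : Fin d → ℝ,
        deriv (fun s => meanValU m d f (Function.update t α s) x) (t α)
          = (1 / 2) * (∏ β ∈ Finset.univ.erase α, t β) *
              lapX (meanValU m d f t) x := by

  obtain ⟨C, hC⟩ := hfb
  have hg : IsSubgaussian f := .of_bounded hf hC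
  simp_rw [meanValU_eq_gaussAverage]
  refine ⟨?_, fun α t ht x => ?_⟩
  · have hprod : ∀ p ∈ {t : Fin m → ℝ | ∀ α, 0 < t α} ×ˢ (Set.univ : Set (Fin d → ℝ)),
        0 < ∏ α, p.1 α := fun p hp => Finset.prod_pos fun α _ => hp.1 α
    have hv : ContDiff ℝ (⊤ : ℕ∞) fun p : (Fin m → ℝ) × (Fin d → ℝ) => ∏ α, p.1 α :=
      contDiff_prod fun α _ => by fun_prop
    have hs : ContDiffOn ℝ (⊤ : ℕ∞)
        (fun p : (Fin m → ℝ) × (Fin d → ℝ) => (2 * ∏ α, p.1 α)⁻¹)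
        ({t : Fin m → ℝ | ∀ α, 0 < t α} ×ˢ (Set.univ : Set (Fin d → ℝ))) :=
      (contDiff_const.mul hv).contDiffOn.inv fun p hp =>
        (mul_pos two_pos (hprod p hp)).ne'
    have hT : ContDiffOn ℝ (⊤ : ℕ∞) (gaussTransform f) {p | 0 < p.1} :=
      contDiffOn_infty.2 fun n => hg.contDiffOn_integral n
    refine ContDiffOn.mul ?_ (ContDiffOn.mul ?_ ?_)
    · exact (contDiff_const.mul hv).contDiffOn.rpow_const_of_ne fun p hp =>
        (mul_pos (by positivity) (hprod p hp)).ne'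
    · have hq : ContDiff ℝ (⊤ : ℕ∞) fun p : (Fin m → ℝ) × (Fin d → ℝ) => ∑ a, p.2 a ^ 2 :=
        ContDiff.sum fun a _ => by fun_prop
      exact (hs.neg.mul hq.contDiffOn).exp
    · refine hT.comp (hs.prodMk ((contDiffOn_const.mul hs).smul contDiff_snd.contDiffOn))
        fun p hp => ?_
      exact inv_pos.2 (mul_pos two_pos (hprod p hp))
  · have hv : 0 < ∏ β, t β := Finset.prod_pos fun β _ => ht β
    have hupd (s : ℝ) : ∏ β, Function.update t α s β = s * ∏ β ∈ Finset.univ.erase α, t β := by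
      rw [Finset.prod_update_of_mem (Finset.mem_univ α), Finset.sdiff_singleton_eq_erase]
    have hvα : t α * ∏ β ∈ Finset.univ.erase α, t β = ∏ β, t β :=
      Finset.mul_prod_erase _ _ (Finset.mem_univ α)
    simp_rw [hupd]
    have hlin := (hasDerivAt_id' (t α)).mul_const (∏ β ∈ Finset.univ.erase α, t β)
    have h := hg.hasDerivAt_heat (hvα.symm ▸ hv) x
    have hlap : meanValU m d f t = fun x =>
        (2 * π * ∏ α, t α) ^ (-(d : ℝ) / 2) * gaussAverage f (2 * ∏ α, t α)⁻¹ x :=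
      funext fun x => meanValU_eq_gaussAverage f t x
    refine (h.comp (t α) hlin).deriv.trans ?_
    rw [hvα, hlap, lapX_const_mul]
    ring
end
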